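/- For any d ≥ 2 and any positive integer k, the subgraph induced in Λ(d,k) by the d-dimensional lattice simplices (lattice polytopes with exactly d+1 vertices) and the d-dimensional lattice polytopes with exactly d+2 vertices is connected. -/

import Mathlib

open Set

/-- Points of `ℝ^d`. -/
abbrev Pt (d : ℕ) := Fin d → ℝ

/-- A polytope in `ℝ^d` is the convex hull of a finite set of points. -/
def IsPolytope (d : ℕ) (P : Set (Pt d)) : Prop :=
  ∃ S : Finset (Pt d), P = convexHull ℝ (S : Set (Pt d))

/-- A set is `d`-dimensional (full-dimensional) if its affine hull is all of `ℝ^d`. -/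
def FullDim (d : ℕ) (P : Set (Pt d)) : Prop := affineSpan ℝ P = ⊤

/-- A point `x` can be inserted in `P` when the convex hull of `P ∪ {x}` has as its
vertex set (set of extreme points) exactly the vertex set of `P` together with `x`. -/
def CanInsert (d : ℕ) (P : Set (Pt d)) (x : Pt d) : Prop :=
  Set.extremePoints ℝ (convexHull ℝ (P ∪ {x})) = Set.extremePoints ℝ P ∪ {x}

/-- A vertex `v` of `P` can be deleted from `P` when the convex hull of the remaining
vertices is `d`-dimensional. -/
def CanDelete (d : ℕ) (P : Set (Pt d)) (v : Pt d) : Prop :=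
  v ∈ Set.extremePoints ℝ P ∧
    FullDim d (convexHull ℝ (Set.extremePoints ℝ P \ {v}))

/-- `Q` is obtained from `P` by an insertion move. -/
def InsertMove (d : ℕ) (P Q : Set (Pt d)) : Prop :=
  ∃ x : Pt d, CanInsert d P x ∧ Q = convexHull ℝ (P ∪ {x})

/-- `Q` is obtained from `P` by a deletion move. -/
def DeleteMove (d : ℕ) (P Q : Set (Pt d)) : Prop :=
  ∃ v : Pt d, CanDelete d P v ∧ Q = convexHull ℝ (Set.extremePoints ℝ P \ {v})

/-- Adjacency: one polytope is obtained from the other by inserting a point or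
deleting a vertex. -/
def Move (d : ℕ) (P Q : Set (Pt d)) : Prop :=
  InsertMove d P Q ∨ DeleteMove d P Q ∨ InsertMove d Q P ∨ DeleteMove d Q P

/-- There is a path of at most `n` edges from `P` to `Q` all of whose vertices lie in
the class `C` of polytopes (i.e. `P` and `Q` are at distance at most `n` in the subgraph
induced by `C`). -/
def PathLE (d : ℕ) (C : Set (Set (Pt d))) (P Q : Set (Pt d)) (n : ℕ) : Prop :=
  ∃ (m : ℕ) (f : ℕ → Set (Pt d)), m ≤ n ∧ f 0 = P ∧ f m = Q ∧
    (∀ i ≤ m, f i ∈ C) ∧ ∀ i < m, Move d (f i) (f (i + 1))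

/-- The subgraph induced by the class `C` is connected. -/
def ConnectedIn (d : ℕ) (C : Set (Set (Pt d))) : Prop :=
  ∀ P ∈ C, ∀ Q ∈ C, ∃ n, PathLE d C P Q n

/-- The vertex set of the graph `Γ(d)`: the `d`-dimensional polytopes in `ℝ^d`. -/
def Gamma (d : ℕ) : Set (Set (Pt d)) := {P | IsPolytope d P ∧ FullDim d P}

/-- The number of vertices of a polytope. -/
noncomputable def nVerts (d : ℕ) (P : Set (Pt d)) : ℕ := (Set.extremePoints ℝ P).ncard

/-- A lattice point of `ℝ^d`. -/
def IsLatticePt (d : ℕ) (x : Pt d) : Prop := ∀ i, ∃ z : ℤ, x i = (z : ℝ)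

/-- A lattice polytope: all its vertices are lattice points. -/
def IsLatticePoly (d : ℕ) (P : Set (Pt d)) : Prop :=
  ∀ v ∈ Set.extremePoints ℝ P, IsLatticePt d v

/-- The hypercube `[0,k]^d`. -/
def Cube (d k : ℕ) : Set (Pt d) := {x | ∀ i, x i ∈ Set.Icc (0 : ℝ) (k : ℝ)}

/-- The vertex set of `Λ(d)`: the `d`-dimensional lattice polytopes in `ℝ^d`. -/
def Lambda (d : ℕ) : Set (Set (Pt d)) :=
  {P | IsPolytope d P ∧ FullDim d P ∧ IsLatticePoly d P}

/-- The vertex set of `Λ(d,k)`: the `d`-dimensional lattice polytopes in `[0,k]^d`. -/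
def LambdaK (d k : ℕ) : Set (Set (Pt d)) := {P ∈ Lambda d | P ⊆ Cube d k}

/-- A facet of a polytope `P`: an exposed face of dimension `d-1`. -/
def IsFacet (d : ℕ) (P F : Set (Pt d)) : Prop :=
  IsExposed ℝ P F ∧ F.Nonempty ∧ F ≠ P ∧
    Module.finrank ℝ ↥(vectorSpan ℝ F) = d - 1

/-- `H` is the closed half-space `H_F^-(P)` bounded by the affine hull of the facet `F`
and satisfying `P ∩ H = F`. -/
def BoundingHalfspace (d : ℕ) (P F H : Set (Pt d)) : Prop :=
  ∃ (l : (Pt d) →ₗ[ℝ] ℝ) (c : ℝ), l ≠ 0 ∧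
    H = {x | l x ≤ c} ∧
    (affineSpan ℝ F : Set (Pt d)) = {x | l x = c} ∧
    P ∩ H = F

/-- The cone `C_v(P)`: the intersection of the half-spaces `H_F^-(P)` over all facets
`F` of `P` incident to `v`. -/
def Cone (d : ℕ) (P : Set (Pt d)) (v : Pt d) : Set (Pt d) :=
  {x | ∀ F H : Set (Pt d), IsFacet d P F → v ∈ F → BoundingHalfspace d P F H → x ∈ H}

/-- A set `A` is in convex position: every finite subset of `A` is the vertex set of
a polytope, namely of its own convex hull. -/
def ConvexPosition (d : ℕ) (A : Set (Pt d)) : Prop :=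
  ∀ S : Finset (Pt d), (S : Set (Pt d)) ⊆ A →
    Set.extremePoints ℝ (convexHull ℝ (S : Set (Pt d))) = (S : Set (Pt d))

/-- The lattice points of the hypercube `[0,k]^d`. -/
def latticeCube (d k : ℕ) : Set (Pt d) := {x | IsLatticePt d x ∧ x ∈ Cube d k}

/-- The vertex class of the induced subgraph: lattice polytopes in `[0,k]^d` with `d + 1` or
`d + 2` vertices. -/
abbrev smallPolytopes (d k : ℕ) : Set (Set (Pt d)) :=
  {P ∈ LambdaK d k | nVerts d P = d + 1 ∨ nVerts d P = d + 2}

/-- No point of `A` lies in the convex hull of the other points of `A`. -/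
def InConvexPosition {d : ℕ} (A : Set (Pt d)) : Prop :=
  ∀ p ∈ A, p ∉ convexHull ℝ (A \ {p})

/-- Two polytopes are joined by a path in the graph induced by `smallPolytopes`. -/
def PathJoined (d k : ℕ) : Set (Pt d) → Set (Pt d) → Prop :=
  Relation.ReflTransGen fun P Q => P ∈ smallPolytopes d k ∧ Q ∈ smallPolytopes d k ∧ Move d P Q

section Polytopes

variable {d k : ℕ}

lemma latticeCube_finite : (latticeCube d k).Finite := by
  have h : (Set.pi univ fun _ : Fin d => ((fun n : ℕ => (n : ℝ)) '' (Finset.range (k + 1) : Set ℕ))).Finite :=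
    Set.Finite.pi fun _ => (Finset.finite_toSet _).image _
  refine h.subset fun x hx i _ => ?_
  obtain ⟨z, hz⟩ := hx.1 i
  have h0 := hx.2 i
  rw [hz] at h0
  have h1 : 0 ≤ z := by exact_mod_cast h0.1
  have h2 : z ≤ k := by exact_mod_cast h0.2
  refine ⟨z.toNat, ?_, ?_⟩
  · simp; omega
  · simp only [hz]
    exact_mod_cast Int.toNat_of_nonneg h1

lemma convex_cube : Convex ℝ (Cube d k) := by
  have : Cube d k = Set.pi univ fun _ => Set.Icc (0 : ℝ) k := by
    ext x; simp only [Cube, Set.mem_ofPred_eq, Set.mem_pi, mem_univ, true_imp_iff]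
  rw [this]
  exact convex_pi fun _ _ => convex_Icc _ _

lemma convexHull_extremePoints_of_isPolytope {P : Set (Pt d)} (hP : IsPolytope d P) :
    (Set.extremePoints ℝ P).Finite ∧ convexHull ℝ (Set.extremePoints ℝ P) = P := by
  obtain ⟨S, rfl⟩ := hP
  have hfin : (Set.extremePoints ℝ (convexHull ℝ (S : Set (Pt d)))).Finite :=
    S.finite_toSet.subset extremePoints_convexHull_subset
  refine ⟨hfin, ?_⟩
  rw [← (hfin.isClosed_convexHull ℝ).closure_eq]
  exact closure_convexHull_extremePoints (S.finite_toSet.isCompact_convexHull ℝ)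
    (convex_convexHull ℝ _)

lemma InConvexPosition.extremePoints {A : Set (Pt d)} (hA : InConvexPosition A)
    (hfin : A.Finite) : Set.extremePoints ℝ (convexHull ℝ A) = A := by
  refine extremePoints_convexHull_subset.antisymm fun p hp => ?_
  by_contra hpE
  have hP := convexHull_extremePoints_of_isPolytope
    (d := d) (P := convexHull ℝ A) ⟨hfin.toFinset, by simp⟩
  refine hA p hp (convexHull_mono ?_ (hP.2.symm ▸ subset_convexHull ℝ A hp))
  exact fun q hq => ⟨extremePoints_convexHull_subset hq, fun h => hpE (h ▸ hq)⟩

lemma Move.symm {P Q : Set (Pt d)} (h : Move d P Q) : Move d Q P := by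
  unfold Move at *; tauto

lemma PathJoined.symm {P Q : Set (Pt d)} (h : PathJoined d k P Q) : PathJoined d k Q P := by
  have : Std.Symm fun P Q => P ∈ smallPolytopes d k ∧ Q ∈ smallPolytopes d k ∧ Move d P Q :=
    ⟨fun _ _ h => ⟨h.2.1, h.1, h.2.2.symm⟩⟩
  exact Relation.ReflTransGen.stdSymm.symm _ _ h

lemma PathJoined.exists_pathLE {P Q : Set (Pt d)} (hP : P ∈ smallPolytopes d k)
    (h : PathJoined d k P Q) : ∃ n, PathLE d (smallPolytopes d k) P Q n := by
  induction h with
  | refl => exact ⟨0, 0, fun _ => P, le_rfl, rfl, rfl, fun _ _ => hP, by simp⟩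
  | @tail R Q _ hRQ ih =>
    obtain ⟨n, m, f, -, h0, hm, hC, hf⟩ := ih
    refine ⟨m + 1, m + 1, Function.update f (m + 1) Q, le_rfl, ?_, by simp, ?_, ?_⟩
    · rw [Function.update_of_ne (by omega), h0]
    · intro i hi
      rcases Nat.lt_or_ge m i with h | h
      · obtain rfl : i = m + 1 := by omega
        simpa using hRQ.2.1
      · rw [Function.update_of_ne (by omega)]
        exact hC i h
    · intro i hi
      rw [Function.update_of_ne (a := i) (by omega)]
      rcases Nat.lt_or_ge i m with h | h
      · rw [Function.update_of_ne (by omega)]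
        exact hf i h
      · obtain rfl : i = m := by omega
        rw [hm]
        simpa using hRQ.2.2

lemma convexHull_mem_smallPolytopes {A : Set (Pt d)} (hA : InConvexPosition A)
    (hsub : A ⊆ latticeCube d k) (hspan : affineSpan ℝ A = ⊤)
    (hcard : A.ncard = d + 1 ∨ A.ncard = d + 2) : convexHull ℝ A ∈ smallPolytopes d k := by
  have hfin : A.Finite := latticeCube_finite.subset hsub
  refine ⟨⟨⟨⟨hfin.toFinset, by simp⟩, ?_, ?_⟩, ?_⟩, ?_⟩
  · rw [FullDim, affineSpan_convexHull, hspan]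
  · intro v hv
    rw [hA.extremePoints hfin] at hv
    exact (hsub hv).1
  · exact convexHull_min (fun x hx => (hsub hx).2) convex_cube
  · rwa [nVerts, hA.extremePoints hfin]

lemma InConvexPosition.mono {A B : Set (Pt d)} (hB : InConvexPosition B) (h : A ⊆ B) :
    InConvexPosition A := fun p hp hpA =>
  hB p (h hp) (convexHull_mono (sdiff_subset_sdiff_left h) hpA)

/-- Inserting a point in a simplex, keeping convex position, is an edge of the graph. -/
lemma joined_insert {A : Set (Pt d)} {x : Pt d} (hA : InConvexPosition (insert x A))
    (hxA : x ∉ A) (hsub : insert x A ⊆ latticeCube d k) (hspan : affineSpan ℝ A = ⊤)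
    (hcard : A.ncard = d + 1) :
    PathJoined d k (convexHull ℝ A) (convexHull ℝ (insert x A)) := by
  have hA' := hA.mono (subset_insert x A)
  have hfin : A.Finite := latticeCube_finite.subset ((subset_insert x A).trans hsub)
  have key : convexHull ℝ (convexHull ℝ A ∪ {x}) = convexHull ℝ (insert x A) := by
    rw [convexHull_convexHull_union_left, union_singleton]
  refine Relation.ReflTransGen.single ⟨?_, ?_, Or.inl ⟨x, ?_, key.symm⟩⟩
  · exact convexHull_mem_smallPolytopes hA' ((subset_insert x A).trans hsub) hspan (Or.inl hcard)
  · refine convexHull_mem_smallPolytopes hA hsub ?_ (Or.inr ?_)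
    · exact top_unique (hspan ▸ affineSpan_mono ℝ (subset_insert x A))
    · rw [ncard_insert_of_notMem hxA hfin, hcard]
  · rw [CanInsert, key, hA.extremePoints (hfin.insert x), hA'.extremePoints hfin, union_singleton]

lemma inConvexPosition_of_subset_extremePoints {K A : Set (Pt d)} (hK : Convex ℝ K)
    (hA : A ⊆ Set.extremePoints ℝ K) : InConvexPosition A :=
  InConvexPosition.mono
    (convexIndependent_set_iff_notMem_convexHull_sdiff.1 hK.convexIndependent_extremePoints) hA

end Polytopes

/-- Affine bases of `ℝ^d`, seen as `d`-dimensional simplices with labelled vertices. -/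
abbrev LabelledSimplex (d : ℕ) := AffineBasis (Option (Fin d)) ℝ (Pt d)

/-- The square matrix whose rows are the homogeneous coordinates of the given points. -/
def homMatrix {d : ℕ} (v : Option (Fin d) → Pt d) : Matrix (Option (Fin d)) (Option (Fin d)) ℝ :=
  Matrix.of fun i c => c.elim 1 (v i)

section Simplices

variable {d k : ℕ}

lemma affineIndependent_iff_det_ne_zero (v : Option (Fin d) → Pt d) :
    AffineIndependent ℝ v ↔ (homMatrix v).det ≠ 0 := by
  rw [affineIndependent_iff_of_fintype, ← isUnit_iff_ne_zero, ← Matrix.isUnit_iff_isUnit_det,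
    ← Matrix.linearIndependent_rows_iff_isUnit, Fintype.linearIndependent_iff]
  refine forall_congr' fun w => ?_
  have key : ∑ i, w i • (homMatrix v).row i = 0 ↔ ∑ i, w i = 0 ∧ ∑ i, w i • v i = 0 := by
    constructor
    · intro h
      refine ⟨by simpa [homMatrix] using congrFun h none, funext fun r => ?_⟩
      simpa [homMatrix] using congrFun h (some r)
    · rintro ⟨h1, h2⟩
      funext c
      cases c with
      | none => simpa [homMatrix] using h1
      | some r => simpa [homMatrix] using congrFun h2 r
  rw [key, and_imp]
  refine forall_congr' fun h => ?_
  rw [Finset.weightedVSub_eq_linear_combination (hw := h)]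

lemma coord_basis_add (b : LabelledSimplex d) (i j : Option (Fin d)) (x : Pt d) :
    b.coord i (b j + x) = (if i = j then 1 else 0) + (b.coord i).linear x := by
  rw [add_comm, ← vadd_eq_add, AffineMap.map_vadd, b.coord_apply, vadd_eq_add, add_comm]

lemma det_homMatrix_update (b : LabelledSimplex d) (i : Option (Fin d)) (x : Pt d) :
    (homMatrix (Function.update b i x)).det = b.coord i x * (homMatrix b).det := by
  have : homMatrix (Function.update b i x) =
      (homMatrix b).updateRow i (∑ j, b.coord j x • homMatrix b j) := by
    ext l c
    by_cases hl : l = i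
    · subst hl
      rw [Matrix.updateRow_self]
      cases c with
      | none => simp [homMatrix]
      | some r =>
        have := congrFun (b.linear_combination_coord_eq_self x) r
        simp only [Finset.sum_apply, Pi.smul_apply, smul_eq_mul] at this
        simp [homMatrix, this]
    · rw [Matrix.updateRow_ne hl]
      simp [homMatrix, Function.update_of_ne hl]
  rw [this, Matrix.det_updateRow_sum, smul_eq_mul]

lemma det_homMatrix_ne_zero (b : LabelledSimplex d) : (homMatrix b).det ≠ 0 :=
  (affineIndependent_iff_det_ne_zero b).1 b.ind

/-- The simplex with a given family of affinely independent vertices. -/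
def simplexOf (v : Option (Fin d) → Pt d) (hv : AffineIndependent ℝ v) : LabelledSimplex d :=
  ⟨v, hv, hv.affineSpan_eq_top_iff_card_eq_finrank_add_one.2 (by simp)⟩

/-- Replace the vertex of label `i` of a simplex by a point outside the opposite hyperplane. -/
noncomputable def replaceVertex (b : LabelledSimplex d) (i : Option (Fin d)) (x : Pt d)
    (h : b.coord i x ≠ 0) : LabelledSimplex d :=
  simplexOf (Function.update b i x) <| (affineIndependent_iff_det_ne_zero _).2 <| by
    rw [det_homMatrix_update]
    exact mul_ne_zero h (det_homMatrix_ne_zero b)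

@[simp] lemma coe_replaceVertex (b : LabelledSimplex d) (i : Option (Fin d)) (x : Pt d)
    (h : b.coord i x ≠ 0) : ⇑(replaceVertex b i x h) = Function.update b i x := rfl

lemma ncard_range_simplex (b : LabelledSimplex d) : (range b).ncard = d + 1 := by
  rw [Set.ncard_range_of_injective b.ind.injective]
  simp

lemma notMem_convexHull_of_forall_lt (f : Pt d →ᵃ[ℝ] ℝ) (c : ℝ) {A : Set (Pt d)} {p : Pt d}
    (hA : ∀ q ∈ A, c < f q) (hp : f p ≤ c) : p ∉ convexHull ℝ A := by
  intro h
  have hc : Convex ℝ (f ⁻¹' Set.Ioi c) := (convex_Ioi c).affine_preimage f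
  exact absurd (convexHull_min hA hc h) (not_lt.2 hp)

lemma notMem_range_of_coord_neg {b : LabelledSimplex d} {x : Pt d} {l : Option (Fin d)}
    (hl : b.coord l x < 0) : x ∉ range b := by
  rintro ⟨m, rfl⟩
  rw [b.coord_apply] at hl
  split_ifs at hl <;> linarith

lemma inConvexPosition_insert {b : LabelledSimplex d} {x : Pt d} {l i j : Option (Fin d)}
    (hl : b.coord l x < 0) (hij : i ≠ j) (hi : 0 < b.coord i x) (hj : 0 < b.coord j x) :
    InConvexPosition (insert x (range b)) := by
  have hx := notMem_range_of_coord_neg hl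
  rintro p (rfl | ⟨m, rfl⟩)
  · refine notMem_convexHull_of_forall_lt (b.coord l) (b.coord l p) ?_ le_rfl
    rintro q ⟨rfl | ⟨m, rfl⟩, hq⟩
    · exact absurd rfl hq
    · rw [b.coord_apply]
      split_ifs <;> linarith
  · obtain ⟨n, hnm, hn⟩ : ∃ n, n ≠ m ∧ 0 < b.coord n x := by
      by_cases h : i = m
      · exact ⟨j, h ▸ hij.symm, hj⟩
      · exact ⟨i, h, hi⟩
    set M := |b.coord m x| / b.coord n x
    have hM : M * b.coord n x = |b.coord m x| := div_mul_cancel₀ _ hn.ne'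
    have hM0 : 0 ≤ M := by positivity
    have happ : ∀ q, (M • b.coord n - b.coord m) q = M * b.coord n q - b.coord m q :=
      fun q => rfl
    refine notMem_convexHull_of_forall_lt (M • b.coord n - b.coord m) (-1) ?_ ?_
    · rintro q ⟨rfl | ⟨m', rfl⟩, hq⟩
      · rw [happ, hM]
        linarith [le_abs_self (b.coord m q)]
      · have hm : m ≠ m' := fun h => hq (by rw [h]; rfl)
        rw [happ, b.coord_apply, b.coord_apply, if_neg hm]
        split_ifs <;> linarith
    · rw [happ, b.coord_apply, b.coord_apply, if_neg hnm, if_pos rfl]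
      linarith

lemma insert_range_update (b : LabelledSimplex d) (i : Option (Fin d)) (x : Pt d) :
    insert (b i) (range (Function.update b i x)) = insert x (range b) := by
  ext p
  simp only [mem_insert_iff, mem_range]
  constructor
  · rintro (rfl | ⟨j, rfl⟩)
    · exact Or.inr ⟨i, rfl⟩
    · by_cases h : j = i
      · subst h; simp
      · rw [Function.update_of_ne h]; exact Or.inr ⟨j, rfl⟩
  · rintro (rfl | ⟨j, rfl⟩)
    · exact Or.inr ⟨i, by simp⟩
    · by_cases h : j = i
      · subst h; simp
      · exact Or.inr ⟨j, by rw [Function.update_of_ne h]⟩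

/-- The convex hulls of two simplices are joined by a path. -/
def SimplexJoined (k : ℕ) (b b' : LabelledSimplex d) : Prop :=
  PathJoined d k (convexHull ℝ (range b)) (convexHull ℝ (range b'))

lemma simplexJoined_replaceVertex {b : LabelledSimplex d} {i : Option (Fin d)} {x : Pt d}
    (h : b.coord i x ≠ 0) (hb : range b ⊆ latticeCube d k) (hx : x ∈ latticeCube d k)
    (hxb : x ∉ range b) (hc : InConvexPosition (insert x (range b))) :
    SimplexJoined k b (replaceVertex b i x h) := by
  have hsub : insert x (range b) ⊆ latticeCube d k := insert_subset hx hb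
  have h1 := joined_insert hc hxb hsub b.tot (ncard_range_simplex b)
  rw [← insert_range_update b i x] at hc hsub
  have h2 := joined_insert (A := range (replaceVertex b i x h)) hc ?_ hsub
    (replaceVertex b i x h).tot (ncard_range_simplex _)
  · rw [coe_replaceVertex, insert_range_update] at h2
    exact h1.trans h2.symm
  · rintro ⟨j, hj⟩
    rw [coe_replaceVertex] at hj
    by_cases hji : j = i
    · subst hji
      rw [Function.update_self] at hj
      exact hxb ⟨j, hj.symm⟩
    · rw [Function.update_of_ne hji] at hj
      exact hji (b.ind.injective hj)

lemma range_replaceVertex_subset {b : LabelledSimplex d} {i : Option (Fin d)} {x : Pt d} {A : Set (Pt d)}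
    (h : b.coord i x ≠ 0) (hb : range b ⊆ A) (hx : x ∈ A) :
    range (replaceVertex b i x h) ⊆ A := by
  refine (subset_insert (b i) _).trans ?_
  rw [coe_replaceVertex, insert_range_update]
  exact insert_subset hx hb

end Simplices

/-- The point `x` lies outside the simplex `b`, and is not separated from the rest of it by a
single vertex: it can be inserted in `b`. -/
def Insertable {d : ℕ} (b : LabelledSimplex d) (x : Pt d) : Prop :=
  ∃ l i j, b.coord l x < 0 ∧ i ≠ j ∧ 0 < b.coord i x ∧ 0 < b.coord j x

/-- A lattice simplex whose volume is maximal in its connected component. -/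
def HasMaxVolume {d : ℕ} (k : ℕ) (b : LabelledSimplex d) : Prop :=
  range b ⊆ latticeCube d k ∧ ∀ b' : LabelledSimplex d, range b' ⊆ latticeCube d k →
    SimplexJoined k b b' → |(homMatrix b').det| ≤ |(homMatrix b).det|

/-- The barycentric coordinates of the `r`-th unit vector. -/
noncomputable def unitCoord {d : ℕ} (b : LabelledSimplex d) (r : Fin d) (i : Option (Fin d)) : ℝ :=
  (b.coord i).linear (Pi.single r 1)

section MaxVolume

variable {d k : ℕ} {b : LabelledSimplex d} {i j : Option (Fin d)} {r : Fin d} {x : Pt d} {t : ℝ}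

lemma Insertable.simplexJoined (hx : Insertable b x) (h : b.coord i x ≠ 0)
    (hb : range b ⊆ latticeCube d k) (hxk : x ∈ latticeCube d k) :
    SimplexJoined k b (replaceVertex b i x h) := by
  obtain ⟨l, p, q, hl, hpq, hp, hq⟩ := hx
  exact simplexJoined_replaceVertex h hb hxk (notMem_range_of_coord_neg hl)
    (inConvexPosition_insert hl hpq hp hq)

lemma HasMaxVolume.abs_coord_le_one (hb : HasMaxVolume k b) (hx : Insertable b x)
    (hxk : x ∈ latticeCube d k) (i : Option (Fin d)) : |b.coord i x| ≤ 1 := by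
  by_cases h : b.coord i x = 0
  · simp [h]
  · have := hb.2 _ (range_replaceVertex_subset h hb.1 hxk) (hx.simplexJoined h hb.1 hxk)
    rw [coe_replaceVertex, det_homMatrix_update, abs_mul] at this
    exact le_of_mul_le_mul_right (by linarith) (abs_pos.2 (det_homMatrix_ne_zero b))

lemma HasMaxVolume.replaceVertex (hb : HasMaxVolume k b) (hx : Insertable b x)
    (hxk : x ∈ latticeCube d k) (h : b.coord i x ≠ 0) (h1 : b.coord i x = 1) :
    HasMaxVolume k (replaceVertex b i x h) := by
  refine ⟨range_replaceVertex_subset h hb.1 hxk, fun b' hb' hj => ?_⟩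
  rw [coe_replaceVertex, det_homMatrix_update, h1, one_mul]
  exact hb.2 b' hb' ((hx.simplexJoined h hb.1 hxk).trans hj)

lemma coord_add_smul_single (b : LabelledSimplex d) (i j : Option (Fin d)) (r : Fin d) (t : ℝ) :
    b.coord i (b j + t • Pi.single r 1) = (if i = j then 1 else 0) + t * unitCoord b r i := by
  rw [coord_basis_add, map_smul, smul_eq_mul, unitCoord]

lemma sum_unitCoord (b : LabelledSimplex d) (r : Fin d) : ∑ i, unitCoord b r i = 0 := by
  have h := b.sum_coord_apply_eq_one (b none + (1 : ℝ) • Pi.single r 1)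
  simp only [coord_add_smul_single, Finset.sum_add_distrib, one_mul] at h
  simpa using h

lemma sum_unitCoord_smul (b : LabelledSimplex d) (r : Fin d) :
    ∑ i, unitCoord b r i • b i = Pi.single r 1 := by
  have h := b.linear_combination_coord_eq_self (b none + (1 : ℝ) • Pi.single r 1)
  simp only [coord_add_smul_single, add_smul, Finset.sum_add_distrib, one_mul] at h
  simpa using h

lemma sum_unitCoord_mul (b : LabelledSimplex d) (r : Fin d) :
    ∑ i, unitCoord b r i * b i r = 1 := by
  simpa using congrFun (sum_unitCoord_smul b r) r

lemma exists_unitCoord_ne_zero (b : LabelledSimplex d) (r : Fin d) : ∃ i, unitCoord b r i ≠ 0 := by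
  by_contra! h
  simpa [h] using sum_unitCoord_mul b r

lemma exists_unitCoord_pos (b : LabelledSimplex d) (r : Fin d) : ∃ i, 0 < unitCoord b r i := by
  obtain ⟨i, hi⟩ := exists_unitCoord_ne_zero b r
  obtain ⟨j, -, hj⟩ := Finset.exists_pos_of_sum_zero_of_exists_nonzero _ (sum_unitCoord b r)
    ⟨i, Finset.mem_univ _, hi⟩
  exact ⟨j, hj⟩

lemma exists_unitCoord_neg (b : LabelledSimplex d) (r : Fin d) : ∃ i, unitCoord b r i < 0 := by
  obtain ⟨i, hi⟩ := exists_unitCoord_ne_zero b r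
  obtain ⟨j, -, hj⟩ := Finset.exists_pos_of_sum_zero_of_exists_nonzero (fun i => -unitCoord b r i)
    (by rw [Finset.sum_neg_distrib, sum_unitCoord, neg_zero])
    ⟨i, Finset.mem_univ _, neg_ne_zero.2 hi⟩
  exact ⟨j, by linarith⟩

lemma add_smul_single_mem_latticeCube {p q : Pt d} (hp : p ∈ latticeCube d k)
    (hq : q ∈ latticeCube d k) (h : p r + t = q r) :
    p + t • Pi.single r 1 ∈ latticeCube d k := by
  have key : ∀ s, (p + t • Pi.single r 1 : Pt d) s = p s ∨
      (p + t • Pi.single r 1 : Pt d) s = q s := by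
    intro s
    by_cases hs : s = r
    · subst hs; right; simp [h]
    · left; simp [hs]
  refine ⟨fun s => ?_, fun s => ?_⟩
  · rcases key s with h | h <;> rw [h]
    exacts [hp.1 s, hq.1 s]
  · rcases key s with h | h <;> rw [h]
    exacts [hp.2 s, hq.2 s]

lemma const_mem_latticeCube {c : ℝ} (hc : c = 0 ∨ c = k) :
    (fun _ => c) ∈ latticeCube d k := by
  rcases hc with rfl | rfl
  · exact ⟨fun _ => ⟨0, by simp⟩, fun _ => ⟨le_rfl, by positivity⟩⟩
  · exact ⟨fun _ => ⟨k, by simp⟩, fun _ => ⟨by positivity, le_rfl⟩⟩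

lemma insertable_of_mixed {p q : Option (Fin d)} (hpi : p ≠ i) (hqi : q ≠ i)
    (hp : 0 < unitCoord b r p) (hq : unitCoord b r q < 0) (ht : t ≠ 0)
    (hi : 0 ≤ t * unitCoord b r i) : Insertable b (b i + t • Pi.single r 1) := by
  have hi' : 0 < b.coord i (b i + t • Pi.single r 1) := by
    rw [coord_add_smul_single, if_pos rfl]; linarith
  have key : ∀ m, m ≠ i → b.coord m (b i + t • Pi.single r 1) = t * unitCoord b r m := by
    intro m hm
    rw [coord_add_smul_single, if_neg hm, zero_add]
  rcases lt_or_gt_of_ne ht with ht | ht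
  · exact ⟨p, i, q, by rw [key p hpi]; exact mul_neg_of_neg_of_pos ht hp, hqi.symm, hi',
      by rw [key q hqi]; exact mul_pos_of_neg_of_neg ht hq⟩
  · exact ⟨q, i, p, by rw [key q hqi]; exact mul_neg_of_pos_of_neg ht hq, hpi.symm, hi',
      by rw [key p hpi]; exact mul_pos ht hp⟩

lemma HasMaxVolume.eq_wall_of_mixed (hb : HasMaxVolume k b) {p q : Option (Fin d)} (hpi : p ≠ i)
    (hqi : q ≠ i) (hp : 0 < unitCoord b r p) (hq : unitCoord b r q < 0)
    (hi : unitCoord b r i ≠ 0) : b i r = if 0 < unitCoord b r i then (k : ℝ) else 0 := by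
  set c : ℝ := if 0 < unitCoord b r i then (k : ℝ) else 0 with hc
  have hcube := (hb.1 ⟨i, rfl⟩).2 r
  have hck : c = 0 ∨ c = k := by rw [hc]; split_ifs <;> simp
  by_contra hne
  have ht : c - b i r ≠ 0 := fun h => hne (by linarith)
  have hpos : 0 < (c - b i r) * unitCoord b r i := by
    refine lt_of_le_of_ne ?_ (mul_ne_zero ht hi).symm
    rw [hc]
    split_ifs with h
    · exact mul_nonneg (by linarith [hcube.2]) h.le
    · exact mul_nonneg_of_nonpos_of_nonpos (by linarith [hcube.1]) (not_lt.1 h)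
  have := hb.abs_coord_le_one (insertable_of_mixed hpi hqi hp hq ht hpos.le)
    (add_smul_single_mem_latticeCube (hb.1 ⟨i, rfl⟩) (const_mem_latticeCube hck) (by ring)) i
  rw [coord_add_smul_single, if_pos rfl, abs_of_pos (by linarith)] at this
  linarith

lemma unitCoord_of_edge (hβ : b i = b j + t • Pi.single r 1) (m : Option (Fin d)) :
    t * unitCoord b r m = (if m = i then 1 else 0) - (if m = j then 1 else 0) := by
  have := coord_add_smul_single b m j r t
  rw [← hβ, b.coord_apply] at this
  linarith

lemma HasMaxVolume.le_length_of_base (hk : 1 ≤ k) (hb : HasMaxVolume k b) {u : Option (Fin d)}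
    (hij : i ≠ j) (hui : u ≠ i) (huj : u ≠ j) (hβ : b i = b j + t • Pi.single r 1) (ht : 0 < t)
    (hu : b u r = 0) : (k : ℝ) ≤ t := by
  have hk0 : (0 : ℝ) < k := by exact_mod_cast hk
  have hi := unitCoord_of_edge hβ i
  have hj := unitCoord_of_edge hβ j
  have hu' := unitCoord_of_edge hβ u
  rw [if_pos rfl, if_neg hij] at hi
  rw [if_pos rfl, if_neg hij.symm] at hj
  rw [if_neg hui, if_neg huj] at hu'
  have hip : 0 < unitCoord b r i := pos_of_mul_pos_right (by linarith) ht.le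
  have hjn : unitCoord b r j < 0 := by
    by_contra! h
    nlinarith
  have hu0 : unitCoord b r u = 0 := by
    rcases mul_eq_zero.1 (hu'.trans (sub_zero 0)) with h | h
    · exact absurd h ht.ne'
    · exact h
  have := hb.abs_coord_le_one
    (insertable_of_mixed (t := (k : ℝ)) hui.symm huj.symm hip hjn hk0.ne' (by simp [hu0]))
    (add_smul_single_mem_latticeCube (hb.1 ⟨u, rfl⟩) (const_mem_latticeCube (Or.inr rfl))
      (by rw [hu, zero_add])) i
  rw [coord_add_smul_single, if_neg hui.symm, zero_add, abs_of_pos (mul_pos hk0 hip)] at this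
  calc (k : ℝ) = t * (k * unitCoord b r i) := by linear_combination (-(k : ℝ)) * hi
    _ ≤ t * 1 := by gcongr
    _ = t := mul_one t

lemma HasMaxVolume.le_length_of_pos (hd : 2 ≤ d) (hk : 1 ≤ k) (hb : HasMaxVolume k b)
    (hij : i ≠ j) (hβ : b i = b j + t • Pi.single r 1) (ht : 0 < t) : (k : ℝ) ≤ t := by
  obtain ⟨u, -, hu⟩ := Finset.exists_mem_notMem_of_card_lt_card (s := {i, j})
    (t := (Finset.univ : Finset (Option (Fin d))))
    (Finset.card_le_two.trans_lt (by simp; omega))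
  simp only [Finset.mem_insert, Finset.mem_singleton, not_or] at hu
  by_cases hu0 : b u r = 0
  · exact hb.le_length_of_base hk hij hu.1 hu.2 hβ ht hu0
  obtain ⟨p, hp⟩ := exists_unitCoord_pos b r
  obtain ⟨q, hq⟩ := exists_unitCoord_neg b r
  have hu' := unitCoord_of_edge hβ u
  rw [if_neg hu.1, if_neg hu.2, sub_zero] at hu'
  have hur : unitCoord b r u = 0 := (mul_eq_zero.1 hu').resolve_left ht.ne'
  have h1 : b.coord u (b u + (-b u r) • Pi.single r 1) = 1 := by
    rw [coord_add_smul_single, hur, if_pos rfl]; ring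
  have hins : Insertable b (b u + (-b u r) • Pi.single r 1) :=
    insertable_of_mixed (fun h => by rw [h] at hp; linarith) (fun h => by rw [h] at hq; linarith)
      hp hq (neg_ne_zero.2 hu0) (by rw [hur, mul_zero])
  have hmem : b u + (-b u r) • Pi.single r 1 ∈ latticeCube d k :=
    add_smul_single_mem_latticeCube (hb.1 ⟨u, rfl⟩) (const_mem_latticeCube (Or.inl rfl)) (by ring)
  refine (hb.replaceVertex hins hmem (by rw [h1]; exact one_ne_zero) h1).le_length_of_base
    (u := u) hk hij hu.1 hu.2 (r := r) ?_ ht ?_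
  · rw [coe_replaceVertex, Function.update_of_ne (Ne.symm hu.1),
      Function.update_of_ne (Ne.symm hu.2), hβ]
  · rw [coe_replaceVertex, Function.update_self]
    simp

lemma HasMaxVolume.le_length (hd : 2 ≤ d) (hk : 1 ≤ k) (hb : HasMaxVolume k b)
    (hij : i ≠ j) (hβ : b i = b j + t • Pi.single r 1) (ht : t ≠ 0) : (k : ℝ) ≤ |t| := by
  rcases lt_or_gt_of_ne ht with h | h
  · rw [abs_of_neg h]
    refine hb.le_length_of_pos (r := r) hd hk hij.symm ?_ (neg_pos.2 h)
    rw [hβ, neg_smul, add_neg_cancel_right]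
  · rw [abs_of_pos h]
    exact hb.le_length_of_pos hd hk hij hβ h

lemma eq_wall_of_le_abs_sub {a c : ℝ} (ha : a ∈ Set.Icc (0 : ℝ) k) (hc : c ∈ Set.Icc (0 : ℝ) k)
    (h : (k : ℝ) ≤ |a - c|) : a = 0 ∨ a = k := by
  rcases abs_cases (a - c) with ⟨h1, -⟩ | ⟨h1, -⟩
  · exact Or.inr (by linarith [ha.2, hc.1])
  · exact Or.inl (by linarith [ha.1, hc.2])

lemma HasMaxVolume.eq_wall_of_pyramid (hd : 2 ≤ d) (hk : 1 ≤ k) (hb : HasMaxVolume k b) {c : ℝ}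
    (hc : c = 0 ∨ c = k) (hbase : ∀ l, l ≠ i → unitCoord b r l ≠ 0 → b l r = c)
    (hsign : ∀ l, l ≠ i → unitCoord b r l * unitCoord b r i ≤ 0) {m : Option (Fin d)}
    (hji : j ≠ i) (hmi : m ≠ i) (hmj : m ≠ j) (hj : unitCoord b r j ≠ 0)
    (hm : unitCoord b r m ≠ 0) : b i r = 0 ∨ b i r = k := by
  set t := b i r - c with ht
  have hti : t * unitCoord b r i = 1 := by
    have h1 : ∑ l, unitCoord b r l * (b l r - c) = 1 := by
      simp only [mul_sub, Finset.sum_sub_distrib, ← Finset.sum_mul, sum_unitCoord,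
        sum_unitCoord_mul]
      ring
    rw [Finset.sum_eq_single i] at h1
    · rw [mul_comm, h1]
    · intro l _ hl
      by_cases h : unitCoord b r l = 0
      · rw [h, zero_mul]
      · rw [hbase l hl h, sub_self, mul_zero]
    · simp
  have ht0 : t ≠ 0 := left_ne_zero_of_mul_eq_one hti
  have hneg : ∀ l, l ≠ i → t * unitCoord b r l ≤ 0 := by
    intro l hl
    have : t * unitCoord b r l = t ^ 2 * (unitCoord b r l * unitCoord b r i) := by
      linear_combination (-(t * unitCoord b r l)) * hti
    rw [this]
    exact mul_nonpos_of_nonneg_of_nonpos (sq_nonneg t) (hsign l hl)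
  have hmneg : t * unitCoord b r m < 0 := lt_of_le_of_ne (hneg m hmi) (mul_ne_zero ht0 hm)
  have hjpos : 0 < 1 + t * unitCoord b r j := by
    have h0 : ∑ l, -(t * unitCoord b r l) = 0 := by
      rw [Finset.sum_neg_distrib, ← Finset.mul_sum, sum_unitCoord, mul_zero, neg_zero]
    rw [← Finset.add_sum_erase _ _ (Finset.mem_univ i)] at h0
    have h2 : ∑ l ∈ {j, m}, -(t * unitCoord b r l) ≤
        ∑ l ∈ Finset.univ.erase i, -(t * unitCoord b r l) := by
      refine Finset.sum_le_sum_of_subset_of_nonneg ?_ ?_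
      · intro l hl
        simp only [Finset.mem_insert, Finset.mem_singleton] at hl
        rcases hl with rfl | rfl <;> simp [*]
      · intro l hl _
        linarith [hneg l (Finset.ne_of_mem_erase hl)]
    rw [Finset.sum_pair hmj.symm] at h2
    linarith
  have hins : Insertable b (b j + t • Pi.single r 1) := by
    refine ⟨m, i, j, ?_, hji.symm, ?_, ?_⟩
    · rw [coord_add_smul_single, if_neg hmj, zero_add]; exact hmneg
    · rw [coord_add_smul_single, if_neg hji.symm, hti]; norm_num
    · rw [coord_add_smul_single, if_pos rfl]; exact hjpos
  have h1 : b.coord i (b j + t • Pi.single r 1) = 1 := by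
    rw [coord_add_smul_single, if_neg hji.symm, hti, zero_add]
  have hmem : b j + t • Pi.single r 1 ∈ latticeCube d k :=
    add_smul_single_mem_latticeCube (hb.1 ⟨j, rfl⟩) (hb.1 ⟨i, rfl⟩)
      (by rw [hbase j hji hj, ht]; ring)
  have hle := (hb.replaceVertex hins hmem (by rw [h1]; exact one_ne_zero) h1).le_length hd hk
    (i := i) (j := j) (r := r) (t := t) hji.symm
    (by rw [coe_replaceVertex, Function.update_self, Function.update_of_ne hji]) ht0
  exact eq_wall_of_le_abs_sub ((hb.1 ⟨i, rfl⟩).2 r)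
    ((const_mem_latticeCube (d := d) hc).2 r) hle

lemma HasMaxVolume.eq_wall (hd : 2 ≤ d) (hk : 1 ≤ k) (hb : HasMaxVolume k b)
    (hi : unitCoord b r i ≠ 0) : b i r = 0 ∨ b i r = k := by
  by_cases hmix : ∃ p q, p ≠ i ∧ q ≠ i ∧ 0 < unitCoord b r p ∧ unitCoord b r q < 0
  · obtain ⟨p, q, hpi, hqi, hp, hq⟩ := hmix
    rw [hb.eq_wall_of_mixed hpi hqi hp hq hi]
    split_ifs <;> simp
  push Not at hmix
  have hsign : ∀ l, l ≠ i → unitCoord b r l * unitCoord b r i ≤ 0 := by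
    intro l hl
    obtain ⟨p, hp⟩ := exists_unitCoord_pos b r
    obtain ⟨q, hq⟩ := exists_unitCoord_neg b r
    rcases lt_or_gt_of_ne hi with h | h
    · refine mul_nonpos_of_nonneg_of_nonpos ?_ h.le
      exact hmix p l (fun e => by rw [e] at hp; linarith) hl hp
    · refine mul_nonpos_of_nonpos_of_nonneg ?_ h.le
      by_contra! hl'
      exact absurd (hmix l q hl (fun e => by rw [e] at hq; linarith) hl') (not_le.2 hq)
  obtain ⟨j, hji, hj⟩ : ∃ j, j ≠ i ∧ unitCoord b r j ≠ 0 := by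
    by_contra! h
    have := sum_unitCoord b r
    rw [Finset.sum_eq_single i (fun l _ hl => h l hl) (by simp)] at this
    exact hi this
  by_cases hm : ∃ m, m ≠ i ∧ m ≠ j ∧ unitCoord b r m ≠ 0
  · obtain ⟨m, hmi, hmj, hm⟩ := hm
    refine hb.eq_wall_of_pyramid hd hk (c := if 0 < unitCoord b r i then 0 else k)
      (by split_ifs <;> simp) ?_ hsign hji hmi hmj hj hm
    intro l hl hl0
    obtain ⟨n, hnl, hni, hn⟩ : ∃ n, n ≠ l ∧ n ≠ i ∧ unitCoord b r n ≠ 0 := by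
      by_cases h : l = j
      · exact ⟨m, h ▸ hmj, hmi, hm⟩
      · exact ⟨j, fun e => h e.symm, hji, hj⟩
    have hsl := hsign l hl
    have hsn := hsign n hni
    rcases lt_or_gt_of_ne hi with h | h
    · have hlp : 0 < unitCoord b r l :=
        lt_of_le_of_ne (by by_contra! h'; nlinarith) hl0.symm
      have hnp : 0 < unitCoord b r n :=
        lt_of_le_of_ne (by by_contra! h'; nlinarith) hn.symm
      rw [hb.eq_wall_of_mixed hnl hl.symm hnp h hl0, if_pos hlp, if_neg (not_lt.2 h.le)]
    · have hlp : unitCoord b r l < 0 :=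
        lt_of_le_of_ne (by by_contra! h'; nlinarith) hl0
      have hnp : unitCoord b r n < 0 :=
        lt_of_le_of_ne (by by_contra! h'; nlinarith) hn
      rw [hb.eq_wall_of_mixed hl.symm hnl h hnp hl0, if_neg (not_lt.2 hlp.le), if_pos h]
  · push Not at hm
    have hsum := sum_unitCoord b r
    have hvec := sum_unitCoord_smul b r
    have hout : ∀ l, l ∉ ({i, j} : Finset (Option (Fin d))) → unitCoord b r l = 0 := by
      intro l hl
      simp only [Finset.mem_insert, Finset.mem_singleton, not_or] at hl
      exact hm l hl.1 hl.2
    rw [← Finset.sum_subset (Finset.subset_univ {i, j}) (fun l _ hl => hout l hl),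
      Finset.sum_pair hji.symm] at hsum
    rw [← Finset.sum_subset (Finset.subset_univ {i, j})
      (fun l _ hl => by rw [hout l hl, zero_smul]), Finset.sum_pair hji.symm] at hvec
    have hj' : unitCoord b r j = -unitCoord b r i := by linarith
    have hβ : b i = b j + (unitCoord b r i)⁻¹ • Pi.single r 1 := by
      rw [← hvec, hj', smul_add, smul_smul, smul_smul, inv_mul_cancel₀ hi, mul_neg,
        inv_mul_cancel₀ hi]
      simp
    have hle := hb.le_length hd hk hji.symm hβ (inv_ne_zero hi)
    refine eq_wall_of_le_abs_sub ((hb.1 ⟨i, rfl⟩).2 r) ((hb.1 ⟨j, rfl⟩).2 r) (hle.trans_eq ?_)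
    rw [hβ]
    simp

end MaxVolume

/-- The vertices of the hypercube `[0,k]^d`. -/
def cubeVertices (d k : ℕ) : Set (Pt d) := {x | ∀ r, x r = 0 ∨ x r = k}

section Corners

variable {d k : ℕ}

lemma cubeVertices_subset_extremePoints :
    cubeVertices d k ⊆ Set.extremePoints ℝ (Cube d k) := by
  have : Cube d k = Set.pi univ fun _ => Set.Icc (0 : ℝ) k := by
    ext x; simp only [Cube, Set.mem_ofPred_eq, Set.mem_pi, mem_univ, true_imp_iff]
  rw [this, extremePoints_pi]
  intro x hx r _
  rw [Set.extremePoints_Icc (Nat.cast_nonneg k)]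
  exact hx r

lemma cubeVertices_subset_latticeCube : cubeVertices d k ⊆ latticeCube d k := fun _ hx =>
  ⟨fun r => (const_mem_latticeCube (d := d) (hx r)).1 r,
    fun r => (const_mem_latticeCube (d := d) (hx r)).2 r⟩

lemma finite_setOf_latticeSimplex :
    {b : LabelledSimplex d | range b ⊆ latticeCube d k}.Finite := by
  refine Set.Finite.of_finite_image (f := fun b : LabelledSimplex d => (b : Option (Fin d) → Pt d))
    ((Set.Finite.pi fun _ => latticeCube_finite (d := d) (k := k)).subset ?_)
    (fun _ _ _ _ h => AffineBasis.ext h)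
  rintro _ ⟨b, hb, rfl⟩ i _
  exact hb ⟨i, rfl⟩

lemma exists_simplexJoined_cubeVertices (hd : 2 ≤ d) (hk : 1 ≤ k) (b : LabelledSimplex d)
    (hb : range b ⊆ latticeCube d k) :
    ∃ b' : LabelledSimplex d, SimplexJoined k b b' ∧ range b' ⊆ cubeVertices d k := by
  obtain ⟨b₁, ⟨hb₁, hj₁⟩, hmax₁⟩ := Set.exists_max_image
    {v : LabelledSimplex d | range v ⊆ latticeCube d k ∧ SimplexJoined k b v}
    (fun v => |(homMatrix v).det|) (finite_setOf_latticeSimplex.subset fun _ h => h.1)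
    ⟨b, hb, Relation.ReflTransGen.refl⟩
  have hvol₁ : HasMaxVolume k b₁ := ⟨hb₁, fun v hv hj => hmax₁ v ⟨hv, hj₁.trans hj⟩⟩
  let wall (v : LabelledSimplex d) : Set (Option (Fin d) × Fin d) :=
    {p | v p.1 p.2 = 0 ∨ v p.1 p.2 = k}
  obtain ⟨b₂, ⟨hb₂, hj₂⟩, hmax₂⟩ := Set.exists_max_image
    {v : LabelledSimplex d | HasMaxVolume k v ∧ SimplexJoined k b v} (fun v => (wall v).ncard)
    (finite_setOf_latticeSimplex.subset fun _ h => h.1.1) ⟨b₁, hvol₁, hj₁⟩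
  refine ⟨b₂, hj₂, ?_⟩
  rintro _ ⟨i, rfl⟩ r
  by_cases hi : unitCoord b₂ r i = 0
  swap
  · exact hb₂.eq_wall hd hk hi
  by_contra hne
  push Not at hne
  obtain ⟨p, hp⟩ := exists_unitCoord_pos b₂ r
  obtain ⟨q, hq⟩ := exists_unitCoord_neg b₂ r
  have h1 : b₂.coord i (b₂ i + (-b₂ i r) • Pi.single r 1) = 1 := by
    rw [coord_add_smul_single, hi, if_pos rfl, mul_zero, add_zero]
  have h0 : b₂.coord i (b₂ i + (-b₂ i r) • Pi.single r 1) ≠ 0 := by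
    rw [h1]; exact one_ne_zero
  have hins : Insertable b₂ (b₂ i + (-b₂ i r) • Pi.single r 1) :=
    insertable_of_mixed (fun h => by rw [h] at hp; linarith) (fun h => by rw [h] at hq; linarith)
      hp hq (neg_ne_zero.2 hne.1) (by rw [hi, mul_zero])
  have hmem : b₂ i + (-b₂ i r) • Pi.single r 1 ∈ latticeCube d k :=
    add_smul_single_mem_latticeCube (hb₂.1 ⟨i, rfl⟩) (const_mem_latticeCube (Or.inl rfl)) (by ring)
  refine not_lt.2 (hmax₂ (replaceVertex b₂ i _ h0) ⟨hb₂.replaceVertex hins hmem h0 h1,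
    hj₂.trans (hins.simplexJoined h0 hb₂.1 hmem)⟩) (Set.ncard_lt_ncard ?_)
  rw [Set.ssubset_iff_of_subset]
  · exact ⟨(i, r), Or.inl (by simp), by simp [wall, hne]⟩
  · rintro ⟨j, s⟩ hjs
    simp only [wall, Set.mem_ofPred_eq, coe_replaceVertex] at hjs ⊢
    by_cases hji : j = i
    · subst hji
      rw [Function.update_self]
      by_cases hs : s = r
      · subst hs; simp
      · simpa [hs] using hjs
    · rwa [Function.update_of_ne hji]

lemma exists_coord_ne_zero {b c : LabelledSimplex d} {j : Option (Fin d)} (hj : c j ∉ range b) :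
    ∃ i, b i ∉ range c ∧ b.coord i (c j) ≠ 0 := by
  by_contra! h
  have h1 := Finset.univ.map_affineCombination b (fun i => b.coord i (c j))
    (b.sum_coord_apply_eq_one _) (c.coord j)
  rw [b.affineCombination_coord_eq_self, c.coord_apply_eq,
    Finset.affineCombination_eq_linear_combination _ _ _ (b.sum_coord_apply_eq_one _),
    Finset.sum_eq_zero] at h1
  · exact one_ne_zero h1
  · intro i _
    by_cases hi : b i ∈ range c
    · obtain ⟨l, hl⟩ := hi
      rw [Function.comp_apply, ← hl, c.coord_apply_ne, smul_zero]
      rintro rfl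
      exact hj ⟨i, hl.symm⟩
    · rw [h i hi, zero_smul]

lemma simplexJoined_of_subset_cubeVertices {b c : LabelledSimplex d}
    (hb : range b ⊆ cubeVertices d k) (hc : range c ⊆ cubeVertices d k) :
    SimplexJoined k b c := by
  induction hn : (range c \ range b).ncard using Nat.strong_induction_on generalizing b with
  | _ n ih =>
    subst hn
    by_cases hsub : range c ⊆ range b
    · have : range c = range b := Set.eq_of_subset_of_ncard_le hsub
        (by rw [ncard_range_simplex, ncard_range_simplex]) (Set.finite_range b)
      rw [SimplexJoined, this]
      exact Relation.ReflTransGen.refl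
    obtain ⟨_, ⟨j, rfl⟩, hj⟩ := Set.not_subset.1 hsub
    obtain ⟨i, hic, hi⟩ := exists_coord_ne_zero hj
    have hcj := hc ⟨j, rfl⟩
    have hjoin := simplexJoined_replaceVertex hi (hb.trans cubeVertices_subset_latticeCube)
      (cubeVertices_subset_latticeCube hcj) hj
      (inConvexPosition_of_subset_extremePoints convex_cube
        ((insert_subset hcj hb).trans cubeVertices_subset_extremePoints))
    refine hjoin.trans (ih _ ?_ (range_replaceVertex_subset hi hb hcj) rfl)
    refine Set.ncard_lt_ncard ?_ ((Set.finite_range c).subset sdiff_subset)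
    rw [Set.ssubset_iff_of_subset]
    · refine ⟨c j, ⟨⟨j, rfl⟩, hj⟩, fun h => h.2 ⟨i, ?_⟩⟩
      rw [coe_replaceVertex, Function.update_self]
    · rintro _ ⟨⟨l, rfl⟩, hl⟩
      refine ⟨⟨l, rfl⟩, ?_⟩
      rintro ⟨m, hm⟩
      refine hl ⟨m, ?_⟩
      rw [coe_replaceVertex, Function.update_of_ne, hm]
      rintro rfl
      exact hic ⟨l, hm.symm⟩

lemma exists_pathJoined_simplex {P : Set (Pt d)} (hP : P ∈ smallPolytopes d k) :
    ∃ b : LabelledSimplex d, range b ⊆ latticeCube d k ∧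
      PathJoined d k P (convexHull ℝ (range b)) := by
  obtain ⟨⟨⟨hpoly, hfull, hlat⟩, hcube⟩, hcard⟩ := hP
  obtain ⟨hfin, hhull⟩ := convexHull_extremePoints_of_isPolytope hpoly
  set E := Set.extremePoints ℝ P with hE
  have hspan : affineSpan ℝ E = ⊤ := by
    rw [← affineSpan_convexHull, hhull]; exact hfull
  have hEk : E ⊆ latticeCube d k := fun v hv => ⟨hlat v hv, hcube hv.1⟩
  obtain ⟨A, hAE, b₀, hb₀⟩ := AffineBasis.exists_affine_subbasis hspan
  have : Fintype A := (hfin.subset hAE).fintype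
  have hA : Fintype.card A = Fintype.card (Option (Fin d)) := by
    rw [b₀.card_eq_finrank_add_one]; simp
  let b : LabelledSimplex d := b₀.reindex (Fintype.equivOfCardEq hA)
  have hb : range b = A := by
    rw [AffineBasis.coe_reindex, hb₀, Set.range_comp, Equiv.range_eq_univ, Set.image_univ,
      Subtype.range_coe]
  refine ⟨b, hb ▸ hAE.trans hEk, ?_⟩
  have hbA := ncard_range_simplex b
  rw [hb] at hbA ⊢
  have hdiff := Set.ncard_sdiff_add_ncard_of_subset hAE hfin
  have hcard' : E.ncard = d + 1 ∨ E.ncard = d + 2 := hcard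
  rw [← hhull]
  rcases hcard' with h | h
  · rw [Set.eq_of_subset_of_ncard_le hAE (by omega) hfin]
    exact Relation.ReflTransGen.refl
  · obtain ⟨x, hx⟩ := Set.ncard_eq_one.1 (show (E \ A).ncard = 1 by omega)
    have hxE : x ∈ E \ A := hx ▸ rfl
    have hins : insert x A = E := by
      rw [← Set.sdiff_union_of_subset hAE, hx, Set.singleton_union]
    rw [← hins]
    refine (joined_insert ?_ hxE.2 (hins ▸ hEk) (hb ▸ b.tot) hbA).symm
    rw [hins]
    exact inConvexPosition_of_subset_extremePoints (hhull ▸ convex_convexHull ℝ E) subset_rfl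

end Corners

/-- the subgraph induced in `Λ(d,k)` by the lattice simplices and the
lattice polytopes with `d + 2` vertices is connected. -/
theorem stmt_11 (d k : ℕ) (hd : 2 ≤ d) (hk : 1 ≤ k) :
    ConnectedIn d {P ∈ LambdaK d k | nVerts d P = d + 1 ∨ nVerts d P = d + 2} := by
  intro P hP Q hQ
  obtain ⟨b, hb, hPb⟩ := exists_pathJoined_simplex hP
  obtain ⟨c, hc, hQc⟩ := exists_pathJoined_simplex hQ
  obtain ⟨b', hbb', hb'⟩ := exists_simplexJoined_cubeVertices hd hk b hb
  obtain ⟨c', hcc', hc'⟩ := exists_simplexJoined_cubeVertices hd hk c hc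
  have hbc : SimplexJoined k b' c' := simplexJoined_of_subset_cubeVertices hb' hc'
  exact PathJoined.exists_pathLE hP
    (hPb.trans (hbb'.trans (hbc.trans ((PathJoined.symm hcc').trans (PathJoined.symm hQc)))))
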